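/- arXiv:1606.05628 — 2 statements merged into one kernel-verified Lean document; each statement's English description precedes it below -/
import Mathlib

section
/- Let ε > 0, let k and d ≥ k(2/ε)^k be positive integers, and let n be a positive integer. Every ordered graph H with N ≥ 2d^{2k+1}ε^{−1}n vertices, whose vertex set is partitioned into an order-obeying sequence of intervals I₁,…,I_{N/d} each of size d, and which has at least εN² edges, contains the k-blow-up P^k_n of the alternating path on n vertices as an ordered subgraph respecting the partitioning (each block of P^k_n lies in a distinct interval I_i). -/
/-- Position of the `j`-th vertex (0-indexed) of the path in the alternating order. -/
def altPos (n j : ℕ) : ℕ := if j % 2 = 0 then j / 2 else n - (j + 1) / 2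

/-- `pathRel n i j` : positions `i`, `j` host consecutive path vertices. -/
def pathRel (n i j : ℕ) : Prop := ∃ m, m + 1 < n ∧ i = altPos n m ∧ j = altPos n (m + 1)

/-- The `k`-blow-up of the alternating path on `n` vertices: blocks of size `k`,
block `i` completely joined to block `j` whenever `{i,j}` is an edge of the
alternating path. -/
def blowup (k n : ℕ) : SimpleGraph (Fin (k * n)) :=
  SimpleGraph.fromRel (fun a b => pathRel n ((a : ℕ) / k) ((b : ℕ) / k))

theorem desc_bound (d : ℕ) : ∀ k : ℕ, k ≤ d →
    (d : ℝ) * d ^ k ≤ d * (d.descFactorial k : ℝ) + (k : ℝ) * (k - 1) / 2 * d ^ k := by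
  intro k
  induction k with
  | zero => intro _; simp
  | succ k ih =>
    intro h
    have h1 := ih (by omega)
    have h2 : ((d - k : ℕ) : ℝ) = (d : ℝ) - k := by
      rw [Nat.cast_sub (by omega)]
    have h3 : (k : ℝ) ≤ d := by exact_mod_cast (by omega : k ≤ d)
    have h3' : (0:ℝ) ≤ k := by positivity
    have hP : (0:ℝ) ≤ (d:ℝ)^k := by positivity
    rw [Nat.descFactorial_succ]
    push_cast
    rw [h2, pow_succ]
    have h4 := mul_le_mul_of_nonneg_left h1 (sub_nonneg.2 h3)
    have h5 : 0 ≤ (k:ℝ) * ((k:ℝ) * (k-1)/2) * (d:ℝ)^k := by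
      rcases Nat.eq_zero_or_pos k with rfl | hk
      · simp
      · have : (1:ℝ) ≤ k := by exact_mod_cast hk
        have : 0 ≤ (k:ℝ) - 1 := by linarith
        positivity
    nlinarith

open Classical in
theorem kst (k d : ℕ) (hk : 0 < k) (hkd : k ≤ d) (p : ℝ) (hp : 0 ≤ p)
    (hd : (k : ℝ) * (3 / 2) ^ k ≤ d * p ^ k) (R : Fin d → Fin d → Prop)
    (hR : p * d ^ 2 ≤ ((Finset.univ.filter (fun z : Fin d × Fin d => R z.1 z.2)).card : ℝ)) :
    ∃ S T : Fin k → Fin d, StrictMono S ∧ StrictMono T ∧ ∀ a b, R (S a) (T b) := by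
  have hd0 : 0 < d := by omega
  have hdR : (0:ℝ) < d := by exact_mod_cast hd0
  let c : (Fin k → Fin d) → ℕ := fun s => (Finset.univ.filter (fun y => ∀ i, R (s i) y)).card
  let deg : Fin d → ℕ := fun y => (Finset.univ.filter (fun x => R x y)).card
  have key : ∃ s : Fin k → Fin d, Function.Injective s ∧ k ≤ c s := by
    by_contra hcon
    push Not at hcon
    have hsum1 : ((Finset.univ.filter (fun z : Fin d × Fin d => R z.1 z.2)).card) = ∑ y, deg y := by
      rw [Finset.card_filter, Fintype.sum_prod_type_right]
      simp only [deg, Finset.card_filter]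
    have hsum2 : ∑ y, deg y ^ k = ∑ s, c s := by
      have h1 : ∀ y, deg y ^ k = (Finset.univ.filter (fun s : Fin k → Fin d => ∀ i, R (s i) y)).card := by
        intro y
        have : (Finset.univ.filter (fun s : Fin k → Fin d => ∀ i, R (s i) y))
            = Fintype.piFinset (fun _ : Fin k => Finset.univ.filter (fun x => R x y)) := by
          ext s; simp
        rw [this, Fintype.card_piFinset]
        simp [deg]
      simp only [h1, c, Finset.card_filter]
      rw [Finset.sum_comm]
    have hpm : (p * d ^ 2) ^ k / (d:ℝ) ^ (k - 1) ≤ ∑ y, (deg y : ℝ) ^ k := by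
      obtain ⟨m, rfl⟩ : ∃ m, k = m + 1 := ⟨k - 1, by omega⟩
      have h := pow_sum_div_card_le_sum_pow (s := (Finset.univ : Finset (Fin d)))
        (f := fun y => (deg y : ℝ)) (fun _ _ => by positivity) m
      refine le_trans ?_ h
      rw [hsum1] at hR
      push_cast at hR
      simp only [Finset.card_univ, Fintype.card_fin, Nat.add_sub_cancel]
      gcongr
    have hc : ∀ s, (c s : ℝ) ≤ if Function.Injective s then (k:ℝ) - 1 else d := by
      intro s
      split_ifs with h
      · have := hcon s h
        have : c s + 1 ≤ k := this
        have : (c s : ℝ) + 1 ≤ k := by exact_mod_cast this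
        linarith
      · have : c s ≤ d := by
          simpa using Finset.card_le_univ (Finset.univ.filter (fun y => ∀ i, R (s i) y))
        exact_mod_cast this
    have hinj : ((Finset.univ.filter (fun s : Fin k → Fin d => Function.Injective s)).card)
        = d.descFactorial k := by
      rw [← Fintype.card_subtype, Fintype.card_congr (Equiv.subtypeInjectiveEquivEmbedding _ _)]
      simp
    have hinj2 : ((Finset.univ.filter (fun s : Fin k → Fin d => ¬ Function.Injective s)).card : ℝ)
        = d ^ k - d.descFactorial k := by
      have := Finset.card_filter_add_card_filter_not (s := (Finset.univ : Finset (Fin k → Fin d)))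
        (fun s => Function.Injective s)
      rw [hinj] at this
      simp only [Finset.card_univ, Fintype.card_fun, Fintype.card_fin] at this
      rw [eq_sub_iff_add_eq, add_comm]
      exact_mod_cast this
    have hup : ∑ s, (c s : ℝ) ≤ (d.descFactorial k : ℝ) * (k - 1) + (d ^ k - d.descFactorial k) * d := by
      refine (Finset.sum_le_sum (fun s _ => hc s)).trans ?_
      rw [Finset.sum_ite]
      simp only [Finset.sum_const, nsmul_eq_mul]
      rw [hinj, hinj2]
    have hlow : (d:ℝ) ^ k * (d * p ^ k) ≤ ∑ s, (c s : ℝ) := by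
      have e1 : (∑ s, (c s : ℝ)) = ∑ y, (deg y : ℝ) ^ k := by exact_mod_cast hsum2.symm
      rw [e1]
      refine le_trans (le_of_eq ?_) hpm
      obtain ⟨m, rfl⟩ : ∃ m, k = m + 1 := ⟨k - 1, by omega⟩
      simp only [Nat.add_sub_cancel]
      field_simp
      ring
    have hdb := desc_bound d k hkd
    have hdf : (d.descFactorial k : ℝ) ≤ d ^ k := by exact_mod_cast Nat.descFactorial_le_pow d k
    have hk1 : (1:ℝ) ≤ k := by exact_mod_cast hk
    have hP : (0:ℝ) < (d:ℝ)^k := by positivity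
    have hb : 1 + (k:ℝ) * (1/2) ≤ (3/2:ℝ)^k := by
      have := one_add_mul_le_pow (a := (1/2:ℝ)) (by norm_num) k
      norm_num at this ⊢
      linarith
    have h1 : (d:ℝ) ^ k * (k * (1 + (k:ℝ) * (1/2))) ≤ (d:ℝ)^k * (d * p^k) := by
      apply mul_le_mul_of_nonneg_left _ hP.le
      refine le_trans ?_ hd
      exact mul_le_mul_of_nonneg_left hb (by linarith)
    have h2 : (d.descFactorial k : ℝ) * (k - 1) ≤ d^k * (k-1) :=
      mul_le_mul_of_nonneg_right hdf (by linarith)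
    nlinarith
  obtain ⟨s, hs, hcs⟩ := key
  obtain ⟨T, hT, hTc⟩ := Finset.exists_subset_card_eq hcs
  have hSc : (Finset.univ.image s).card = k := by
    rw [Finset.card_image_of_injective _ hs]; simp
  refine ⟨(Finset.univ.image s).orderEmbOfFin hSc, T.orderEmbOfFin hTc,
    OrderEmbedding.strictMono _, OrderEmbedding.strictMono _, ?_⟩
  intro a b
  have h1 := Finset.orderEmbOfFin_mem (Finset.univ.image s) hSc a
  have h2 := hT (Finset.orderEmbOfFin_mem T hTc b)
  simp only [Finset.mem_image, Finset.mem_univ, true_and] at h1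
  obtain ⟨i, hi⟩ := h1
  rw [← hi]
  exact (Finset.mem_filter.1 h2).2 i

open Classical in
theorem zigzag {α : Type*} [LinearOrder α] [Fintype α] : ∀ (t : ℕ) (E : Finset (α × α)),
    (∀ e ∈ E, e.1 < e.2) → t * Fintype.card α < E.card →
    ∃ g : ℕ → α, (∀ m ≤ t, m % 2 = 0 → (g m, g (m + 1)) ∈ E) ∧
      (∀ m ≤ t, m % 2 = 1 → (g (m + 1), g m) ∈ E) ∧
      (∀ a b, a < b → b ≤ t + 1 → a % 2 = 0 → b % 2 = 0 → g a < g b) ∧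
      (∀ a b, a < b → b ≤ t + 1 → a % 2 = 1 → b % 2 = 1 → g b < g a) ∧
      (∀ a b, a ≤ t + 1 → b ≤ t + 1 → a % 2 = 0 → b % 2 = 1 → g a < g b) := by
  intro t
  induction t with
  | zero =>
    intro E hE hc
    obtain ⟨⟨x, y⟩, he⟩ := Finset.card_pos.1 (by omega : 0 < E.card)
    refine ⟨fun m => if m = 0 then x else y, ?_, ?_, ?_, ?_, ?_⟩
    · intro m hm _; obtain rfl : m = 0 := by omega
      simpa using he
    · intro m hm _; omega
    · intro a b _ _ _ _; omega
    · intro a b _ _ _ _; omega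
    · intro a b _ _ _ _
      obtain rfl : a = 0 := by omega
      obtain rfl : b = 1 := by omega
      simpa using hE _ he
  | succ t ih =>
    intro E hE hc
    rcases Nat.mod_two_eq_zero_or_one t with ht | ht
    · -- last vertex is a right vertex
      let B := E.filter (fun e => ∀ i, (i, e.2) ∈ E → i ≤ e.1)
      have hB : B.card ≤ Fintype.card α := by
        rw [← Finset.card_univ]
        apply Finset.card_le_card_of_injOn Prod.snd (fun _ _ => by simp)
        rintro ⟨a, b⟩ h1 ⟨a', b'⟩ h2 h
        simp only [B, Finset.coe_filter, Set.mem_ofPred_eq] at h1 h2 h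
        subst h
        have := le_antisymm (h2.2 a h1.1) (h1.2 a' h2.1)
        rw [this]
      have hc' : t * Fintype.card α < (E \ B).card := by
        have := Finset.le_card_sdiff B E
        have e : (t + 1) * Fintype.card α = t * Fintype.card α + Fintype.card α := by ring
        omega
      obtain ⟨g, h1, h2, h3, h4, h5⟩ := ih (E \ B) (fun e he => hE e (Finset.mem_sdiff.1 he).1) hc'
      have hl := Finset.mem_sdiff.1 (h1 t le_rfl ht)
      have : ∃ i, (i, g (t+1)) ∈ E ∧ g t < i := by
        by_contra hcon
        push Not at hcon
        exact hl.2 (Finset.mem_filter.2 ⟨hl.1, hcon⟩)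
      obtain ⟨i, hi, hgi⟩ := this
      have hlt : i < g (t+1) := hE _ hi
      have hG : ∀ m, m ≤ t + 1 → Function.update g (t+2) i m = g m := fun m hm => by
        rw [Function.update_of_ne (by omega)]
      have hG2 : Function.update g (t+2) i (t+2) = i := by simp
      refine ⟨Function.update g (t+2) i, ?_, ?_, ?_, ?_, ?_⟩
      · intro m hm hm2
        rw [hG m (by omega), hG (m+1) (by omega)]
        exact (Finset.mem_sdiff.1 (h1 m (by omega) hm2)).1
      · intro m hm hm2
        rcases Nat.lt_or_ge t m with h | h
        · obtain rfl : m = t + 1 := by omega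
          rw [hG2, hG _ le_rfl]; exact hi
        · rw [hG m (by omega), hG (m+1) (by omega)]
          exact (Finset.mem_sdiff.1 (h2 m (by omega) hm2)).1
      · intro a b hab hb ha2 hb2
        rw [hG a (by omega)]
        rcases Nat.lt_or_ge (t+1) b with h | h
        · obtain rfl : b = t + 2 := by omega
          rw [hG2]
          rcases Nat.lt_or_ge a t with h' | h'
          · exact (h3 a t h' (by omega) ha2 ht).trans hgi
          · obtain rfl : a = t := by omega
            exact hgi
        · rw [hG b h]; exact h3 a b hab h ha2 hb2
      · intro a b hab hb ha2 hb2
        rw [hG a (by omega), hG b (by omega)]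
        exact h4 a b hab (by omega) ha2 hb2
      · intro a b ha hb ha2 hb2
        rw [hG b (by omega)]
        rcases Nat.lt_or_ge (t+1) a with h | h
        · obtain rfl : a = t + 2 := by omega
          rw [hG2]
          rcases Nat.lt_or_ge b (t+1) with h' | h'
          · exact hlt.trans (h4 b (t+1) h' (by omega) hb2 (by omega))
          · obtain rfl : b = t + 1 := by omega
            exact hlt
        · rw [hG a h]; exact h5 a b h (by omega) ha2 hb2
    · let B := E.filter (fun e => ∀ i, (e.1, i) ∈ E → e.2 ≤ i)
      have hB : B.card ≤ Fintype.card α := by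
        rw [← Finset.card_univ]
        apply Finset.card_le_card_of_injOn Prod.fst (fun _ _ => by simp)
        rintro ⟨a, b⟩ h1 ⟨a', b'⟩ h2 h
        simp only [B, Finset.coe_filter, Set.mem_ofPred_eq] at h1 h2 h
        subst h
        have := le_antisymm (h1.2 b' h2.1) (h2.2 b h1.1)
        rw [this]
      have hc' : t * Fintype.card α < (E \ B).card := by
        have := Finset.le_card_sdiff B E
        have e : (t + 1) * Fintype.card α = t * Fintype.card α + Fintype.card α := by ring
        omega
      obtain ⟨g, h1, h2, h3, h4, h5⟩ := ih (E \ B) (fun e he => hE e (Finset.mem_sdiff.1 he).1) hc'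
      have hl := Finset.mem_sdiff.1 (h2 t le_rfl ht)
      have : ∃ i, (g (t+1), i) ∈ E ∧ i < g t := by
        by_contra hcon
        push Not at hcon
        exact hl.2 (Finset.mem_filter.2 ⟨hl.1, hcon⟩)
      obtain ⟨i, hi, hgi⟩ := this
      have hlt : g (t+1) < i := hE _ hi
      have hG : ∀ m, m ≤ t + 1 → Function.update g (t+2) i m = g m := fun m hm => by
        rw [Function.update_of_ne (by omega)]
      have hG2 : Function.update g (t+2) i (t+2) = i := by simp
      refine ⟨Function.update g (t+2) i, ?_, ?_, ?_, ?_, ?_⟩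
      · intro m hm hm2
        rcases Nat.lt_or_ge t m with h | h
        · obtain rfl : m = t + 1 := by omega
          rw [hG2, hG _ le_rfl]; exact hi
        · rw [hG m (by omega), hG (m+1) (by omega)]
          exact (Finset.mem_sdiff.1 (h1 m (by omega) hm2)).1
      · intro m hm hm2
        rw [hG m (by omega), hG (m+1) (by omega)]
        exact (Finset.mem_sdiff.1 (h2 m (by omega) hm2)).1
      · intro a b hab hb ha2 hb2
        rw [hG a (by omega), hG b (by omega)]
        exact h3 a b hab (by omega) ha2 hb2
      · intro a b hab hb ha2 hb2
        rw [hG a (by omega)]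
        rcases Nat.lt_or_ge (t+1) b with h | h
        · obtain rfl : b = t + 2 := by omega
          rw [hG2]
          rcases Nat.lt_or_ge a t with h' | h'
          · exact hgi.trans (h4 a t h' (by omega) ha2 ht)
          · obtain rfl : a = t := by omega
            exact hgi
        · rw [hG b h]; exact h4 a b hab h ha2 hb2
      · intro a b ha hb ha2 hb2
        rw [hG a (by omega)]
        rcases Nat.lt_or_ge (t+1) b with h | h
        · obtain rfl : b = t + 2 := by omega
          rw [hG2]
          rcases Nat.lt_or_ge a (t+1) with h' | h'
          · exact (h3 a (t+1) h' (by omega) ha2 (by omega)).trans hlt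
          · obtain rfl : a = t + 1 := by omega
            exact hlt
        · rw [hG b h]; exact h5 a b (by omega) h ha2 hb2

/-- Encoded vertex. -/
def vtx {M d : ℕ} (i : Fin M) (a : Fin d) : Fin (M * d) := finProdFinEquiv (i, a)

theorem vtx_val {M d : ℕ} (i : Fin M) (a : Fin d) : (vtx i a : ℕ) = a + d * i := rfl

/-- path index from position -/
def pidx (n p : ℕ) : ℕ := if 2 * p < n then 2 * p else 2 * (n - p) - 1

theorem pidx_altPos (n m : ℕ) (h : m < n) : pidx n (altPos n m) = m := by
  unfold pidx altPos
  split_ifs <;> omega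

theorem embed (k d n M : ℕ) (hk : 0 < k) (H : SimpleGraph (Fin (M * d)))
    (S T : Fin k → Fin d) (hS : StrictMono S) (hT : StrictMono T) (E : Finset (Fin M × Fin M))
    (hE : ∀ e ∈ E, e.1 < e.2 ∧ ∀ a b, H.Adj (vtx e.1 (S a)) (vtx e.2 (T b)))
    (hc : (n - 1) * M < E.card) :
    ∃ f : Fin (k * n) → Fin (M * d), StrictMono f ∧
      (∀ u v, (blowup k n).Adj u v → H.Adj (f u) (f v)) ∧
      (∀ u v : Fin (k * n), (u : ℕ) / k = (v : ℕ) / k → (f u : ℕ) / d = (f v : ℕ) / d) ∧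
      (∀ u v : Fin (k * n), (u : ℕ) / k ≠ (v : ℕ) / k → (f u : ℕ) / d ≠ (f v : ℕ) / d) := by
  obtain ⟨g, h1, h2, h3, h4, h5⟩ := zigzag (n - 1) E (fun e he => (hE e he).1) (by simpa using hc)
  let L : ℕ → Fin k → Fin d := fun m => if m % 2 = 0 then S else T
  have hL : ∀ m, StrictMono (L m) := by
    intro m; simp only [L]; split_ifs <;> assumption
  have hadj : ∀ m, m + 1 < n → ∀ a b, H.Adj (vtx (g m) (L m a)) (vtx (g (m+1)) (L (m+1) b)) := by
    intro m hm a b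
    rcases Nat.mod_two_eq_zero_or_one m with h | h
    · have e2 : (m+1) % 2 ≠ 0 := by omega
      simp only [L, h, e2, if_true, if_false]
      exact (hE _ (h1 m (by omega) h)).2 a b
    · have e2 : (m+1) % 2 = 0 := by omega
      have e1 : m % 2 ≠ 0 := by omega
      simp only [L, e1, e2, if_true, if_false]
      exact ((hE _ (h2 m (by omega) h)).2 b a).symm
  have hmono : ∀ p q, p < q → q < n → g (pidx n p) < g (pidx n q) := by
    intro p q hpq hq
    unfold pidx
    split_ifs with hp hq'
    · exact h3 _ _ (by omega) (by omega) (by omega) (by omega)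
    · exact h5 _ _ (by omega) (by omega) (by omega) (by omega)
    · omega
    · exact h4 _ _ (by omega) (by omega) (by omega) (by omega)
  let f : Fin (k * n) → Fin (M * d) := fun u =>
    vtx (g (pidx n (u / k))) (L (pidx n (u / k)) ⟨u % k, Nat.mod_lt _ hk⟩)
  have hdiv : ∀ u, (f u : ℕ) / d = g (pidx n (u / k)) := by
    intro u
    have hlt := (L (pidx n (u / k)) ⟨u % k, Nat.mod_lt _ hk⟩).2
    simp only [f, vtx_val]
    rw [Nat.add_mul_div_left _ _ (by omega), Nat.div_eq_of_lt hlt, zero_add]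
  have hun : ∀ u : Fin (k * n), (u : ℕ) / k < n := fun u => Nat.div_lt_of_lt_mul u.2
  refine ⟨f, ?_, ?_, ?_, ?_⟩
  · intro u v huv
    have huv' : (u : ℕ) < v := huv
    rcases (Nat.div_le_div_right (c := k) huv'.le).lt_or_eq with h | h
    · have h6 := hmono _ _ h (hun v)
      by_contra hcon
      have h7 : (f v : ℕ) / d ≤ (f u : ℕ) / d := Nat.div_le_div_right (not_lt.1 hcon)
      rw [hdiv, hdiv] at h7
      exact absurd h6 (not_lt.2 h7)
    · have hr : (u : ℕ) % k < v % k := by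
        have a1 := Nat.div_add_mod (u:ℕ) k
        have a2 := Nat.div_add_mod (v:ℕ) k
        rw [h] at a1
        omega
      have h8 : L (pidx n (v / k)) ⟨u % k, Nat.mod_lt _ hk⟩ < L (pidx n (v / k)) ⟨v % k, Nat.mod_lt _ hk⟩ :=
        hL _ hr
      show (f u : ℕ) < f v
      simp only [f, vtx_val, h]
      exact Nat.add_lt_add_right h8 _
  · have main : ∀ u v : Fin (k * n), pathRel n ((u : ℕ) / k) ((v : ℕ) / k) → H.Adj (f u) (f v) := by
      rintro u v ⟨m, hm, e1, e2⟩
      simp only [f, e1, e2]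
      rw [pidx_altPos n m (by omega), pidx_altPos n (m+1) hm]
      exact hadj m hm _ _
    intro u v huv
    simp only [blowup, SimpleGraph.fromRel_adj] at huv
    rcases huv.2 with h | h
    · exact main u v h
    · exact (main v u h).symm
  · intro u v h
    rw [hdiv, hdiv, h]
  · intro u v h
    rw [hdiv, hdiv]
    intro h9
    have h9 := Fin.ext h9
    rcases lt_or_gt_of_ne h with h | h
    · exact absurd h9 (hmono _ _ h (hun v)).ne
    · exact absurd h9 (hmono _ _ h (hun u)).ne'

open Classical in
/-- number of edges between two intervals -/
noncomputable def eb {M d : ℕ} (H : SimpleGraph (Fin (M * d))) (i j : Fin M) : ℕ :=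
  (Finset.univ.filter (fun z : Fin d × Fin d => H.Adj (vtx i z.1) (vtx j z.2))).card

theorem eb_symm {M d : ℕ} (H : SimpleGraph (Fin (M * d))) (i j : Fin M) : eb H i j = eb H j i := by
  classical
  unfold eb
  apply Finset.card_bij (fun z _ => (z.2, z.1))
  · intro z hz
    simp only [Finset.mem_filter, Finset.mem_univ, true_and] at hz ⊢
    exact hz.symm
  · rintro ⟨a, b⟩ _ ⟨c, e⟩ _ h
    simp only [Prod.mk.injEq] at h ⊢
    exact ⟨h.2, h.1⟩
  · rintro ⟨a, b⟩ h
    simp only [Finset.mem_filter, Finset.mem_univ, true_and] at h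
    exact ⟨(b, a), by simpa using h.symm, rfl⟩

theorem eb_le {M d : ℕ} (H : SimpleGraph (Fin (M * d))) (i j : Fin M) : eb H i j ≤ d ^ 2 := by
  classical
  refine (Finset.card_le_univ _).trans ?_
  simp [pow_two]

theorem eb_sum {M d : ℕ} (H : SimpleGraph (Fin (M * d))) [DecidableRel H.Adj] :
    ∑ i, ∑ j, eb H i j = 2 * H.edgeFinset.card := by
  classical
  rw [← SimpleGraph.sum_degrees_eq_twice_card_edges]
  rw [← finProdFinEquiv.sum_comp, Fintype.sum_prod_type]
  refine Finset.sum_congr rfl (fun i _ => ?_)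
  have : ∀ x, H.degree x = ∑ j, ∑ b, if H.Adj x (vtx j b) then 1 else 0 := by
    intro x
    rw [← SimpleGraph.card_neighborFinset_eq_degree, SimpleGraph.neighborFinset_eq_filter,
      Finset.card_filter, ← finProdFinEquiv.sum_comp, Fintype.sum_prod_type]
    rfl
  simp only [this]
  rw [Finset.sum_comm]
  refine Finset.sum_congr rfl (fun j _ => ?_)
  unfold eb
  rw [Finset.card_filter, Fintype.sum_prod_type]
  refine Finset.sum_congr rfl (fun a _ => Finset.sum_congr rfl (fun b _ => ?_))
  simp only [vtx]
  congr 1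

open Classical in
theorem dense_count {M d : ℕ} (H : SimpleGraph (Fin (M * d))) [DecidableRel H.Adj] (p : ℝ) (hp : 0 ≤ p) :
    2 * (H.edgeFinset.card : ℝ) ≤ M * d ^ 2 + p * d ^ 2 * M ^ 2 +
      2 * d ^ 2 * ((Finset.univ.filter
        (fun e : Fin M × Fin M => e.1 < e.2 ∧ p * d ^ 2 ≤ eb H e.1 e.2)).card : ℝ) := by
  have h0 : (2 * (H.edgeFinset.card : ℝ)) = ∑ e : Fin M × Fin M, (eb H e.1 e.2 : ℝ) := by
    rw [Fintype.sum_prod_type]; exact_mod_cast (eb_sum H).symm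
  have hb : ∀ e : Fin M × Fin M, (eb H e.1 e.2 : ℝ) ≤ (if e.1 = e.2 then (d:ℝ)^2 else 0) + p * d ^ 2
      + ((if e.1 < e.2 ∧ p * d ^ 2 ≤ eb H e.1 e.2 then (d:ℝ)^2 else 0)
      + (if e.2 < e.1 ∧ p * d ^ 2 ≤ eb H e.2 e.1 then (d:ℝ)^2 else 0)) := by
    intro e
    have hle : (eb H e.1 e.2 : ℝ) ≤ d ^ 2 := by exact_mod_cast eb_le H e.1 e.2
    have hq : 0 ≤ p * (d:ℝ) ^ 2 := by positivity
    have hd2 : 0 ≤ (d:ℝ)^2 := by positivity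
    rw [eb_symm H e.2 e.1]
    by_cases hd : p * d ^ 2 ≤ eb H e.1 e.2
    · rcases lt_trichotomy e.1 e.2 with h | h | h
      · simp [h, hd, h.ne, h.not_gt]; linarith
      · simp [h]; rw [h] at hle; linarith
      · simp [h, hd, h.ne', h.not_gt]; linarith
    · have := (not_le.1 hd).le
      simp only [hd, and_false, if_false, add_zero]
      split_ifs <;> linarith
  rw [h0]
  refine (Finset.sum_le_sum (fun e _ => hb e)).trans (le_of_eq ?_)
  rw [Finset.sum_add_distrib, Finset.sum_add_distrib, Finset.sum_add_distrib]
  have e1 : ∑ e : Fin M × Fin M, (if e.1 = e.2 then (d:ℝ)^2 else 0) = M * d^2 := by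
    rw [Fintype.sum_prod_type]; simp
  have e2 : ∑ e : Fin M × Fin M, (if e.2 < e.1 ∧ p * d ^ 2 ≤ eb H e.2 e.1 then (d:ℝ)^2 else 0)
      = ∑ e : Fin M × Fin M, (if e.1 < e.2 ∧ p * d ^ 2 ≤ eb H e.1 e.2 then (d:ℝ)^2 else 0) := by
    exact (Equiv.prodComm (Fin M) (Fin M)).sum_comp
      (fun e : Fin M × Fin M => if e.1 < e.2 ∧ p * d ^ 2 ≤ eb H e.1 e.2 then (d:ℝ)^2 else 0)
  have e3 : ∑ e : Fin M × Fin M, (if e.1 < e.2 ∧ p * d ^ 2 ≤ eb H e.1 e.2 then (d:ℝ)^2 else 0)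
      = ((Finset.univ.filter
        (fun e : Fin M × Fin M => e.1 < e.2 ∧ p * d ^ 2 ≤ eb H e.1 e.2)).card : ℝ) * d ^ 2 := by
    rw [← Finset.sum_filter]; simp
  rw [e1, e2, e3]
  simp
  ring

theorem stmt14 (ε : ℝ) (hε : 0 < ε) (k d n N : ℕ) (hk : 0 < k) (hn : 0 < n) (hd0 : 0 < d)
    (hd : (k : ℝ) * (2 / ε) ^ k ≤ d) (hdN : d ∣ N)
    (hN : 2 * (d : ℝ) ^ (2 * k + 1) * ε⁻¹ * n ≤ N)
    (H : SimpleGraph (Fin N)) [DecidableRel H.Adj]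
    (hE : ε * N ^ 2 ≤ H.edgeFinset.card) :
    ∃ f : Fin (k * n) → Fin N, StrictMono f ∧
      (∀ u v, (blowup k n).Adj u v → H.Adj (f u) (f v)) ∧
      (∀ u v : Fin (k * n), (u : ℕ) / k = (v : ℕ) / k → (f u : ℕ) / d = (f v : ℕ) / d) ∧
      (∀ u v : Fin (k * n), (u : ℕ) / k ≠ (v : ℕ) / k → (f u : ℕ) / d ≠ (f v : ℕ) / d) := by
  classical
  obtain ⟨M, rfl⟩ := hdN
  revert H
  rw [mul_comm d M] at hN ⊢
  intro H _ hE
  have hdR : (0:ℝ) < d := by exact_mod_cast hd0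
  have hnR : (1:ℝ) ≤ n := by exact_mod_cast hn
  have hkR : (1:ℝ) ≤ k := by exact_mod_cast hk
  have hNpos : (0:ℝ) < ((M * d : ℕ) : ℝ) := lt_of_lt_of_le (by positivity) hN
  have hMR : (0:ℝ) < M := by
    push_cast at hNpos
    exact pos_of_mul_pos_left hNpos hdR.le
  -- ε ≤ 1
  have hε1 : ε ≤ 1 := by
    have h1 : 2 * H.edgeFinset.card ≤ 2 * (M * d) ^ 2 := by
      rw [← eb_sum H]
      calc ∑ i, ∑ j, eb H i j ≤ ∑ i : Fin M, ∑ j : Fin M, d ^ 2 :=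
            Finset.sum_le_sum (fun i _ => Finset.sum_le_sum (fun j _ => eb_le H i j))
        _ = (M * d) ^ 2 := by simp; ring
        _ ≤ _ := by omega
    have h2 : (H.edgeFinset.card : ℝ) ≤ ((M * d : ℕ) : ℝ) ^ 2 := by
      exact_mod_cast (by omega : H.edgeFinset.card ≤ (M * d) ^ 2)
    have h3 : 0 < ((M * d : ℕ) : ℝ) ^ 2 := by positivity
    nlinarith
  have h2ε : (2:ℝ) ≤ 2 / ε := by
    rw [le_div_iff₀ hε]; linarith
  have hpow : (2:ℝ) ≤ (2 / ε) ^ k :=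
    h2ε.trans (le_self_pow₀ (by linarith) (by omega))
  have hd2 : (2:ℝ) ≤ d := by nlinarith
  have hkd : k ≤ d := by
    have : (k:ℝ) ≤ d := by nlinarith
    exact_mod_cast this
  have hM : 2 * (d:ℝ) ^ (2 * k) * n ≤ ε * M := by
    have h1 : 2 * (d : ℝ) ^ (2 * k + 1) * ε⁻¹ * n = (2 * (d:ℝ) ^ (2 * k) * n) / ε * d := by
      rw [pow_succ]; field_simp
    rw [h1] at hN
    push_cast at hN
    have := le_of_mul_le_mul_right hN hdR
    rw [div_le_iff₀ hε] at this
    linarith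
  have hdk : (4:ℝ) ≤ (d:ℝ) ^ (2 * k) := by
    rw [pow_mul]
    have : (4:ℝ) ≤ (d:ℝ)^2 := by nlinarith
    exact this.trans (le_self_pow₀ (by linarith) (by omega))
  set p : ℝ := 3 * ε / 4 with hp
  have hp0 : 0 ≤ p := by positivity
  have hdc := dense_count H p hp0
  set D := Finset.univ.filter
        (fun e : Fin M × Fin M => e.1 < e.2 ∧ p * d ^ 2 ≤ eb H e.1 e.2) with hD
  have hDcard : ε * M ^ 2 / 2 ≤ (D.card : ℝ) := by
    push_cast at hE
    have h4 : 4 ≤ ε * M := by nlinarith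
    have h5 : 2 * (ε * (M * d) ^ 2) ≤ (M * d ^ 2 + p * d ^ 2 * M ^ 2 + 2 * d ^ 2 * (D.card : ℝ)) := by
      linarith
    have h6 : (d:ℝ)^2 * (2 * ε * M^2) ≤ d^2 * (M + p * M^2 + 2 * D.card) := by
      calc _ = 2 * (ε * (M * d) ^ 2) := by ring
        _ ≤ _ := h5
        _ = _ := by ring
    have h7 := le_of_mul_le_mul_left h6 (by positivity)
    rw [hp] at h7
    have h8 : 4 * (M:ℝ) ≤ ε * M * M := mul_le_mul_of_nonneg_right h4 hMR.le
    nlinarith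
  have hkst : (k : ℝ) * (3 / 2) ^ k ≤ d * p ^ k := by
    have h1 : (k:ℝ) * (3/2)^k = (k * (2/ε)^k) * p^k := by
      rw [mul_assoc, ← mul_pow, hp]
      congr 2
      field_simp
      norm_num
    rw [h1]
    exact mul_le_mul_of_nonneg_right hd (by positivity)
  have hlab : ∀ e : Fin M × Fin M, ∃ ST : (Fin k → Fin d) × (Fin k → Fin d), e ∈ D →
      StrictMono ST.1 ∧ StrictMono ST.2 ∧ ∀ a b, H.Adj (vtx e.1 (ST.1 a)) (vtx e.2 (ST.2 b)) := by
    intro e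
    by_cases he : e ∈ D
    · obtain ⟨S, T, hS, hT, hST⟩ := kst k d hk hkd p hp0 hkst
        (fun a b => H.Adj (vtx e.1 a) (vtx e.2 b)) (by
          have := (Finset.mem_filter.1 he).2.2
          unfold eb at this
          convert this)
      exact ⟨(S, T), fun _ => ⟨hS, hT, hST⟩⟩
    · exact ⟨(fun _ => ⟨0, hd0⟩, fun _ => ⟨0, hd0⟩), fun h => absurd h he⟩
  choose lab hlab using hlab
  have hpig : ∃ y : (Fin k → Fin d) × (Fin k → Fin d),
      (n - 1) * M < (D.filter (fun e => lab e = y)).card := by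
    by_contra hcon
    push Not at hcon
    have h1 := Finset.card_eq_sum_card_fiberwise (f := lab) (s := D) (t := Finset.univ)
      (fun _ _ => by simp)
    have h2 : D.card ≤ d ^ (2 * k) * ((n - 1) * M) := by
      rw [h1]
      refine (Finset.sum_le_sum (fun y _ => hcon y)).trans (le_of_eq ?_)
      simp only [Finset.sum_const, Finset.card_univ, Fintype.card_prod, Fintype.card_fun,
        Fintype.card_fin, smul_eq_mul]
      ring
    have h3 : (D.card : ℝ) ≤ d ^ (2 * k) * ((n - 1) * M) := by
      have : (D.card : ℝ) ≤ ((d ^ (2 * k) * ((n - 1) * M) : ℕ) : ℝ) := by exact_mod_cast h2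
      push_cast [Nat.cast_sub (show 1 ≤ n from hn)] at this
      exact this
    have h4 := mul_le_mul_of_nonneg_right hM hMR.le
    have h5 : 0 < (d:ℝ) ^ (2 * k) * M := by positivity
    nlinarith
  obtain ⟨y, hy⟩ := hpig
  obtain ⟨e0, he0⟩ := Finset.card_pos.1 (lt_of_le_of_lt (Nat.zero_le _) hy)
  have he0' := Finset.mem_filter.1 he0
  have h0 := hlab e0 he0'.1
  rw [he0'.2] at h0
  refine embed k d n M hk H y.1 y.2 h0.1 h0.2.1 _ ?_ hy
  intro e he
  have he' := Finset.mem_filter.1 he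
  have h1 := hlab e he'.1
  rw [he'.2] at h1
  exact ⟨(Finset.mem_filter.1 he'.1).2.1, h1.2.2⟩
end

section
/- There is an absolute constant C (one may take C = 2^163 · δ^{−10} where δ = δ(1/8) is the constant from the triangle counting lemma) such that every 2-regular graph G on n vertices admits an ordering 𝒢 with OR(𝒢) ≤ Cn. Consequently, every graph on n vertices with maximum degree 2 admits an ordering whose ordered Ramsey number is linear in n. -/
open Finset in
theorem bw_aux (V : Type) [Fintype V] [DecidableEq V]
    (G : SimpleGraph V) [DecidableRel G.Adj] (hd : ∀ v, G.degree v ≤ 2) (v0 : V) (k : ℕ)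
    (hk : k ≤ Fintype.card V) :
    ∃ p : ℕ → V, ∃ S : Finset V, (∀ v, v ∈ S ↔ ∃ i < k, p i = v) ∧
      (∀ i < k, ∀ j < k, p i = p j → i = j) ∧
      (∀ i < k, ∀ j < k, G.Adj (p i) (p j) → i ≤ j + 2) ∧
      (∀ i, i + 2 < k → G.neighborFinset (p i) \ S = ∅) ∧
      (∀ i, i + 2 = k → (G.neighborFinset (p i) \ S).card ≤ 1 ∧
        (G.neighborFinset (p i) \ S).card + (G.neighborFinset (p (i+1)) \ S).card ≤ 2) := by
  induction k with
  | zero => exact ⟨fun _ => v0, ∅, by simp, by simp, by simp, by simp, by simp⟩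
  | succ k ih =>
    obtain ⟨p, S, hS, hinj, hadj, h0, h1⟩ := ih (by omega)
    have hSk : S.card ≤ k := by
      have : S ⊆ (Finset.range k).image p := by
        intro v hv
        obtain ⟨i, hi, rfl⟩ := (hS v).1 hv
        exact Finset.mem_image_of_mem _ (by simpa using hi)
      exact (Finset.card_le_card this).trans (Finset.card_image_le.trans (by simp))
    have hz0 : ∃ z, z ∉ S := by
      by_contra! h
      have : S = Finset.univ := by ext; simp [h]
      rw [this, Finset.card_univ] at hSk
      omega
    have hdeg : ∀ v, (G.neighborFinset v \ S).card ≤ 2 := fun v =>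
      (Finset.card_le_card Finset.sdiff_subset).trans (by simpa using hd v)
    -- choice of the next vertex
    have hz : ∃ z, z ∉ S ∧
        (∀ i, i + 2 = k → G.neighborFinset (p i) \ insert z S = ∅) ∧
        (∀ i, i + 1 = k → (G.neighborFinset (p i) \ insert z S).card ≤ 1 ∧
          (G.neighborFinset (p i) \ insert z S).card +
            (G.neighborFinset z \ insert z S).card ≤ 2) := by
      have sub : ∀ v z, (G.neighborFinset v \ insert z S) ⊆ (G.neighborFinset v \ S) := by
        intro v z; exact Finset.sdiff_subset_sdiff le_rfl (Finset.subset_insert _ _)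
      have dec : ∀ v z, G.Adj v z → z ∉ S →
          (G.neighborFinset v \ insert z S).card + 1 ≤ (G.neighborFinset v \ S).card := by
        intro v z hvz hzS
        apply Finset.card_lt_card
        refine ⟨sub v z, fun h => ?_⟩
        have := h (show z ∈ _ by simp [hvz, hzS])
        simp at this
      have dec' : ∀ v z, G.Adj v z → v ∈ S →
          (G.neighborFinset z \ insert z S).card ≤ 1 := by
        intro v z hvz hvS
        have : (G.neighborFinset z \ insert z S).card < (G.neighborFinset z).card := by
          apply Finset.card_lt_card
          refine ⟨Finset.sdiff_subset, fun h => ?_⟩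
          have := h (show v ∈ _ by simpa using hvz.symm)
          simp [hvS] at this
        have h2 := hd z
        rw [← G.card_neighborFinset_eq_degree] at h2
        omega
      by_cases hy : ∃ i, i + 2 = k ∧ (G.neighborFinset (p i) \ S).Nonempty
      · obtain ⟨i, hi, z, hz⟩ := hy
        simp only [Finset.mem_sdiff, SimpleGraph.mem_neighborFinset] at hz
        obtain ⟨h1a, h1b⟩ := h1 i hi
        have d1 := dec _ _ hz.1 hz.2
        have d2 := dec' _ _ hz.1 ((hS _).2 ⟨i, by omega, rfl⟩)
        refine ⟨z, hz.2, ?_, ?_⟩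
        · intro i' hi'
          obtain rfl : i' = i := by omega
          rw [← Finset.card_eq_zero]; omega
        · intro i' hi'
          obtain rfl : i' = i + 1 := by omega
          have := Finset.card_le_card (sub (p (i+1)) z)
          omega
      · push Not at hy
        have e0 : ∀ z, ∀ i, i + 2 = k → G.neighborFinset (p i) \ insert z S = ∅ := by
          intro z i hi
          exact Finset.subset_empty.1 ((sub _ _).trans (hy i hi).subset)
        by_cases hx : ∃ i, i + 1 = k ∧ (G.neighborFinset (p i) \ S).Nonempty
        · obtain ⟨i, hi, z, hz⟩ := hx
          simp only [Finset.mem_sdiff, SimpleGraph.mem_neighborFinset] at hz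
          have d1 := dec _ _ hz.1 hz.2
          have d2 := dec' _ _ hz.1 ((hS _).2 ⟨i, by omega, rfl⟩)
          refine ⟨z, hz.2, e0 z, ?_⟩
          intro i' hi'
          obtain rfl : i' = i := by omega
          have := hdeg (p i')
          omega
        · push Not at hx
          obtain ⟨z, hz⟩ := hz0
          refine ⟨z, hz, e0 z, ?_⟩
          intro i hi
          have : G.neighborFinset (p i) \ insert z S = ∅ :=
            Finset.subset_empty.1 ((sub _ _).trans (hx i hi).subset)
          rw [this]
          have h3 := Finset.card_le_card (sub z z)
          have := hdeg z
          simp; omega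
    obtain ⟨z, hzS, hz1, hz2⟩ := hz
    have hpk : ∀ i < k, p i ≠ z := fun i hi h => hzS ((hS z).2 ⟨i, hi, h⟩)
    have hne : ∀ i < k, G.Adj (p i) z → k ≤ i + 2 := by
      intro i hi ha
      by_contra! h
      have := h0 i h
      have h4 : z ∈ G.neighborFinset (p i) \ S := by simp [ha, hzS]
      rw [this] at h4
      simp at h4
    have up : ∀ i < k, Function.update p k z i = p i := fun i hi =>
      Function.update_of_ne (by omega) _ _
    have upk : Function.update p k z k = z := Function.update_self _ _ _
    refine ⟨Function.update p k z, insert z S, ?_, ?_, ?_, ?_, ?_⟩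
    · intro v
      rw [Finset.mem_insert, hS]
      constructor
      · rintro (rfl | ⟨i, hi, rfl⟩)
        · exact ⟨k, by omega, upk⟩
        · exact ⟨i, by omega, up i hi⟩
      · rintro ⟨i, hi, rfl⟩
        rcases Nat.lt_succ_iff_lt_or_eq.1 hi with h | rfl
        · exact Or.inr ⟨i, h, (up i h).symm⟩
        · exact Or.inl upk
    · intro i hi j hj h
      rcases Nat.lt_succ_iff_lt_or_eq.1 hi with h1 | rfl <;>
      rcases Nat.lt_succ_iff_lt_or_eq.1 hj with h2 | rfl
      · rw [up i h1, up j h2] at h; exact hinj i h1 j h2 h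
      · rw [up i h1, upk] at h; exact absurd h (hpk i h1)
      · rw [up j h2, upk] at h; exact absurd h.symm (hpk j h2)
      · rfl
    · intro i hi j hj h
      rcases Nat.lt_succ_iff_lt_or_eq.1 hi with h1 | rfl <;>
      rcases Nat.lt_succ_iff_lt_or_eq.1 hj with h2 | rfl
      · rw [up i h1, up j h2] at h; exact hadj i h1 j h2 h
      · omega
      · rw [up j h2, upk] at h; exact hne j h2 h.symm
      · omega
    · intro i hi
      rw [up i (by omega)]
      rcases Nat.lt_succ_iff_lt_or_eq.1 hi with h | h
      · have := h0 i h
        exact Finset.subset_empty.1 ((Finset.sdiff_subset_sdiff le_rfl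
          (Finset.subset_insert _ _)).trans this.subset)
      · exact hz1 i h
    · intro i hi
      obtain rfl : k = i + 1 := by omega
      rw [up i (by omega), upk]
      exact hz2 i rfl

/-- Graphs of maximum degree two have bandwidth at most two. -/
theorem bandwidth_two (V : Type) [Fintype V] [DecidableEq V]
    (G : SimpleGraph V) [DecidableRel G.Adj] (hd : ∀ v, G.degree v ≤ 2) :
    ∃ τ : V → ℕ, Function.Injective τ ∧ (∀ v, τ v < Fintype.card V) ∧
      ∀ u v, G.Adj u v → τ u ≤ τ v + 2 := by
  rcases isEmpty_or_nonempty V with hV | ⟨⟨v0⟩⟩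
  · exact ⟨fun _ => 0, fun a => isEmptyElim a, fun a => isEmptyElim a, fun a => isEmptyElim a⟩
  obtain ⟨p, S, hS, hinj, hadj, -, -⟩ := bw_aux V G hd v0 _ le_rfl
  have hsurj : Function.Surjective (fun i : Fin (Fintype.card V) => p i) := by
    have : Function.Injective (fun i : Fin (Fintype.card V) => p i) := by
      intro i j h
      exact Fin.ext (hinj i i.2 j j.2 h)
    exact ((Fintype.bijective_iff_injective_and_card _).2 ⟨this, by simp⟩).2
  choose q hq using hsurj
  refine ⟨fun v => q v, ?_, fun v => (q v).2, ?_⟩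
  · intro u v h
    have h' : q u = q v := Fin.ext h
    rw [← hq u, ← hq v, h']
  · intro u v h
    apply hadj _ (q u).2 _ (q v).2
    have h1 := hq u
    have h2 := hq v
    simp only at h1 h2
    rw [h1, h2]; exact h

/-- Residue modulo three. -/
def rho (i : ℕ) : Fin 3 := ⟨i % 3, Nat.mod_lt _ (by norm_num)⟩

theorem peel_card {m : ℕ} (H : Finset (Fin 3 → Fin m)) (r : Fin 3) :
    (H.filter (fun x => ∀ t, x r < t → Function.update x r t ∉ H)).card ≤ m ^ 2 := by
  have : (Finset.univ : Finset (Fin 2 → Fin m)).card = m ^ 2 := by simp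
  rw [← this]
  apply Finset.card_le_card_of_injOn (fun x => fun j => x (r.succAbove j)) (by simp)
  have key : ∀ x y : Fin 3 → Fin m, y ∈ H → (∀ t, x r < t → Function.update x r t ∉ H) →
      (∀ j, x (r.succAbove j) = y (r.succAbove j)) → ¬ x r < y r := by
    intro x y hy hx hxy hlt
    apply hx _ hlt
    convert hy using 1
    ext a
    rcases eq_or_ne a r with rfl | h
    · simp
    · obtain ⟨j, rfl⟩ := Fin.exists_succAbove_eq h
      simp [hxy]
  intro x hx y hy h
  simp only [Finset.coe_filter, Set.mem_setOf_eq] at hx hy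
  have hxy : ∀ j, x (r.succAbove j) = y (r.succAbove j) := fun j => congrFun h j
  have h1 := key x y hy.1 hx.2 hxy
  have h2 := key y x hx.1 hy.2 (fun j => (hxy j).symm)
  have h3 : x r = y r := le_antisymm (not_lt.1 h2) (not_lt.1 h1)
  funext a
  rcases eq_or_ne a r with rfl | h
  · exact h3
  · obtain ⟨j, rfl⟩ := Fin.exists_succAbove_eq h
    exact hxy j

/-- A dense tripartite ordered 3-graph contains a long monotone tight path. -/
theorem tight_path {m : ℕ} (k : ℕ) : ∀ (H : Finset (Fin 3 → Fin m)), 3 * m ^ 2 * k < H.card →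
    ∃ s : ℕ → (Fin 3 → Fin m), (∀ j ≤ k, s j ∈ H) ∧
      ∀ j < k, ∃ t, s j (rho j) < t ∧ s (j+1) = Function.update (s j) (rho j) t := by
  induction k with
  | zero =>
    intro H hH
    obtain ⟨x, hx⟩ := Finset.card_pos.1 (by omega : 0 < H.card)
    exact ⟨fun _ => x, fun _ _ => hx, by simp⟩
  | succ k ih =>
    intro H hH
    set H' := H.filter (fun x => ∀ r, ∃ t, x r < t ∧ Function.update x r t ∈ H) with hH'
    have hsub : H ⊆ H' ∪ Finset.univ.biUnion (fun r : Fin 3 =>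
        H.filter (fun x => ∀ t, x r < t → Function.update x r t ∉ H)) := by
      intro x hx
      by_cases h : ∀ r, ∃ t, x r < t ∧ Function.update x r t ∈ H
      · exact Finset.mem_union_left _ (by simp [hH', hx, h])
      · push Not at h
        obtain ⟨r, hr⟩ := h
        apply Finset.mem_union_right
        rw [Finset.mem_biUnion]
        exact ⟨r, Finset.mem_univ _, by rw [Finset.mem_filter]; exact ⟨hx, hr⟩⟩
    have h1 := (Finset.card_le_card hsub).trans (Finset.card_union_le _ _)
    have h2 := Finset.card_biUnion_le_card_mul (Finset.univ : Finset (Fin 3)) (fun r : Fin 3 =>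
        H.filter (fun x => ∀ t, x r < t → Function.update x r t ∉ H)) (m^2)
        (fun r _ => peel_card H r)
    simp only [Finset.card_univ, Fintype.card_fin] at h2
    obtain ⟨s, hs, hst⟩ := ih H' (by nlinarith)
    have hlast := hs k le_rfl
    rw [hH', Finset.mem_filter] at hlast
    obtain ⟨t, ht, htH⟩ := hlast.2 (rho k)
    refine ⟨Function.update s (k+1) (Function.update (s k) (rho k) t), ?_, ?_⟩
    · intro j hj
      rcases Nat.lt_or_ge j (k+1) with h | h
      · rw [Function.update_of_ne (by omega)]
        exact (Finset.mem_filter.1 (hs j (by omega))).1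
      · obtain rfl : j = k + 1 := by omega
        rw [Function.update_self]; exact htH
    · intro j hj
      rw [Function.update_of_ne (by omega : j ≠ k + 1)]
      rcases Nat.lt_or_ge j k with h | h
      · rw [Function.update_of_ne (by omega)]
        exact hst j h
      · obtain rfl : j = k := by omega
        rw [Function.update_self]
        exact ⟨t, ht, rfl⟩

theorem ramsey33 (d : Fin 6 → Fin 6 → Bool) :
    ∃ i j k : Fin 6, i < j ∧ j < k ∧ d i j = d i k ∧ d i j = d j k := by
  have h5 : ∀ a b c e f : Bool, ∃ i j k : Fin 5, i < j ∧ j < k ∧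
      (![a,b,c,e,f] i = ![a,b,c,e,f] j ∧ ![a,b,c,e,f] i = ![a,b,c,e,f] k) := by decide
  obtain ⟨i, j, k, hij, hjk, h1, h2⟩ := h5 (d 0 1) (d 0 2) (d 0 3) (d 0 4) (d 0 5)
  have e : ∀ i : Fin 5, ![d 0 1, d 0 2, d 0 3, d 0 4, d 0 5] i = d 0 i.succ := by
    intro i; fin_cases i <;> rfl
  rw [e, e] at h1 h2
  have hij' := Fin.succ_lt_succ_iff.2 hij
  have hjk' := Fin.succ_lt_succ_iff.2 hjk
  by_cases a1 : d 0 i.succ = d i.succ j.succ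
  · exact ⟨0, _, _, Fin.succ_pos _, hij', h1, a1⟩
  by_cases a2 : d 0 i.succ = d i.succ k.succ
  · exact ⟨0, _, _, Fin.succ_pos _, hij'.trans hjk', h2, a2⟩
  by_cases a3 : d 0 i.succ = d j.succ k.succ
  · exact ⟨0, _, _, Fin.succ_pos _, hjk', h1.symm.trans h2, h1.symm.trans a3⟩
  refine ⟨i.succ, j.succ, k.succ, hij', hjk', ?_, ?_⟩
  · revert a1 a2; cases d 0 i.succ <;> cases d i.succ j.succ <;> cases d i.succ k.succ <;> simp
  · revert a1 a3; cases d 0 i.succ <;> cases d i.succ j.succ <;> cases d j.succ k.succ <;> simp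

/-- Symmetric form of the above. -/
theorem ramsey33' (d : Fin 6 → Fin 6 → Bool) (hd : ∀ i j, d i j = d j i) :
    ∃ (ι : Fin 3 → Fin 6) (col : Bool), StrictMono ι ∧
      ∀ r r', r ≠ r' → d (ι r) (ι r') = col := by
  obtain ⟨i, j, k, hij, hjk, h1, h2⟩ := ramsey33 d
  refine ⟨![i,j,k], d i j, ?_, ?_⟩
  · rw [Fin.strictMono_iff_lt_succ]
    intro a; fin_cases a
    · exact hij
    · exact hjk
  · intro r r' hr
    fin_cases r <;> fin_cases r' <;> simp at hr ⊢
    · exact h1.symm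
    · exact hd _ _
    · exact h2.symm
    · rw [hd]; exact h1.symm
    · rw [hd]; exact h2.symm

theorem fiber_card {m : ℕ} (ι : Fin 3 → Fin 6) (hι : Function.Injective ι)
    (F : Finset (Fin 6 → Fin m)) (x : Fin 3 → Fin m) :
    (F.filter (fun y => y ∘ ι = x)).card ≤ m ^ 3 := by
  classical
  have hc : Fintype.card {a : Fin 6 // a ∉ Set.range ι} = 3 := by
    rw [Fintype.card_subtype_compl]
    have : Fintype.card {a // a ∈ Set.range ι} = 3 := by
      rw [← Fintype.card_congr (Equiv.ofInjective ι hι), Fintype.card_fin]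
    rw [this]; simp
  have : (Finset.univ : Finset ({a : Fin 6 // a ∉ Set.range ι} → Fin m)).card = m ^ 3 := by
    rw [Finset.card_univ, Fintype.card_fun, hc, Fintype.card_fin]
  rw [← this]
  apply Finset.card_le_card_of_injOn (fun y a => y a.1) (by simp)
  intro y hy y' hy' h
  simp only [Finset.coe_filter, Set.mem_setOf_eq] at hy hy'
  funext a
  by_cases ha : a ∈ Set.range ι
  · obtain ⟨r, rfl⟩ := ha
    exact congrFun (hy.2.trans hy'.2.symm) r
  · exact congrFun h ⟨a, ha⟩

theorem dense_triangles {m : ℕ} (hm : 0 < m) (e : Fin 6 → Fin m → Fin 6 → Fin m → Bool)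
    (he : ∀ a b a' b', e a b a' b' = e a' b' a b) :
    ∃ (ι : Fin 3 → Fin 6) (col : Bool), StrictMono ι ∧ ∃ H : Finset (Fin 3 → Fin m),
      m ^ 3 ≤ 432 * H.card ∧
      ∀ x ∈ H, ∀ r r', r ≠ r' → e (ι r) (x r) (ι r') (x r') = col := by
  classical
  have hR : ∀ y : Fin 6 → Fin m, ∃ T : (Fin 3 → Fin 6) × Bool, StrictMono T.1 ∧
      ∀ r r', r ≠ r' → e (T.1 r) (y (T.1 r)) (T.1 r') (y (T.1 r')) = T.2 := by
    intro y
    obtain ⟨ι, col, h1, h2⟩ := ramsey33' (fun i j => e i (y i) j (y j)) (fun i j => he _ _ _ _)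
    exact ⟨(ι, col), h1, h2⟩
  choose Φ hΦ1 hΦ2 using hR
  obtain ⟨T, -, hT⟩ : ∃ T ∈ (Finset.univ : Finset ((Fin 3 → Fin 6) × Bool)),
      m ^ 6 ≤ 432 * ((Finset.univ : Finset (Fin 6 → Fin m)).filter (fun y => Φ y = T)).card := by
    by_contra! h
    have h1 := Finset.card_eq_sum_card_fiberwise (f := Φ)
      (s := (Finset.univ : Finset (Fin 6 → Fin m))) (t := Finset.univ) (by simp)
    have h2 := Finset.sum_lt_sum_of_nonempty (Finset.univ_nonempty) h
    rw [← Finset.mul_sum, ← h1] at h2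
    simp at h2
  set F := (Finset.univ : Finset (Fin 6 → Fin m)).filter (fun y => Φ y = T) with hF
  have hFne : F.Nonempty := by
    rw [← Finset.card_pos]
    have : 0 < m ^ 6 := by positivity
    omega
  obtain ⟨y0, hy0⟩ := hFne
  have hmono : StrictMono T.1 := by
    have := hΦ1 y0
    rwa [(Finset.mem_filter.1 hy0).2] at this
  refine ⟨T.1, T.2, hmono, F.image (fun y => y ∘ T.1), ?_, ?_⟩
  · have h1 := Finset.card_le_mul_card_image (f := fun y : Fin 6 → Fin m => y ∘ T.1) F (m^3)
      (fun x _ => fiber_card T.1 hmono.injective F x)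
    have h3 : 0 < m ^ 3 := by positivity
    have : m ^ 3 * m ^ 3 ≤ m ^ 3 * (432 * (F.image (fun y => y ∘ T.1)).card) := by
      calc m ^ 3 * m ^ 3 = m ^ 6 := by ring
        _ ≤ _ := hT
        _ ≤ 432 * (m ^ 3 * (F.image (fun y => y ∘ T.1)).card) := Nat.mul_le_mul_left _ h1
        _ = _ := by ring
    exact Nat.le_of_mul_le_mul_left this h3
  · intro x hx r r' hr
    obtain ⟨y, hy, rfl⟩ := Finset.mem_image.1 hx
    have := hΦ2 y r r' hr
    rw [(Finset.mem_filter.1 hy).2] at this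
    exact this

/-- A monochromatic square of a path, with the prescribed order. -/
theorem square_path (n : ℕ) (hn : 0 < n) (N : ℕ) (hN : 7782 * n ≤ N)
    (c : Sym2 (Fin N) → Bool) :
    ∃ (g : ℕ → Fin N) (col : Bool),
      (∀ i < n, ∀ j < n, i % 3 < j % 3 → g i < g j) ∧
      (∀ i < n, ∀ j < n, i % 3 = j % 3 → i < j → g i < g j) ∧
      (∀ i < n, ∀ j < n, i < j → j ≤ i + 2 → c s(g i, g j) = col) := by
  obtain ⟨m, hm⟩ : ∃ m, m = 1297 * n := ⟨_, rfl⟩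
  have hm0 : 0 < m := by omega
  have hpos : ∀ (a : Fin 6) (b : Fin m), a.1 * m + b.1 < N := by
    intro a b
    have h1 : a.1 * m ≤ 5 * m := Nat.mul_le_mul_right _ (by omega)
    have := b.2
    omega
  let pos : Fin 6 → Fin m → Fin N := fun a b => ⟨a.1 * m + b.1, hpos a b⟩
  have pos1 : ∀ a a' b b', a < a' → pos a b < pos a' b' := by
    intro a a' b b' h
    show a.1 * m + b.1 < a'.1 * m + b'.1
    have h1 : (a.1 + 1) * m ≤ a'.1 * m := Nat.mul_le_mul_right _ h
    have := b.2
    nlinarith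
  have pos2 : ∀ a b b', b < b' → pos a b < pos a b' := by
    intro a b b' h
    show a.1 * m + b.1 < a.1 * m + b'.1
    have : b.1 < b'.1 := h
    omega
  obtain ⟨ι, col, hι, H, hH, hcol⟩ := dense_triangles hm0
    (fun a b a' b' => c s(pos a b, pos a' b')) (fun a b a' b' => by rw [Sym2.eq_swap])
  obtain ⟨s, hs, hst⟩ := tight_path n H (by
    have : 432 * (3 * m ^ 2 * n) < m ^ 3 := by
      have h2 : 0 < m ^ 2 := by positivity
      have : m ^ 3 = m ^ 2 * (1297 * n) := by rw [← hm]; ring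
      rw [this]
      nlinarith
    omega)
  have step : ∀ j < n, ∀ r, r ≠ rho j → s (j+1) r = s j r := by
    intro j hj r hr
    obtain ⟨t, -, h⟩ := hst j hj
    rw [h, Function.update_of_ne hr]
  have inc : ∀ j < n, s j (rho j) < s (j+1) (rho j) := by
    intro j hj
    obtain ⟨t, ht, h⟩ := hst j hj
    rw [h, Function.update_self]; exact ht
  have rne : ∀ i j, i % 3 ≠ j % 3 → rho i ≠ rho j := by
    intro i j h h'
    exact h (congrArg Fin.val h')
  have req : ∀ i j, i % 3 = j % 3 → rho i = rho j := fun i j h => Fin.ext h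
  have mono3 : ∀ d i, i + 3 * d < n → s i (rho i) ≤ s (i + 3 * d) (rho i) ∧
      (0 < d → s i (rho i) < s (i + 3 * d) (rho i)) := by
    intro d
    induction d with
    | zero => intro i _; simp
    | succ d ih =>
      intro i hi
      have h1 := (ih i (by omega)).1
      have h2 := inc (i + 3 * d) (by omega)
      rw [req (i + 3 * d) i (by omega)] at h2
      have h3 := step (i + 3 * d + 1) (by omega) (rho i) (rne _ _ (by omega))
      have h4 := step (i + 3 * d + 1 + 1) (by omega) (rho i) (rne _ _ (by omega))
      have h5 : i + 3 * (d + 1) = i + 3 * d + 1 + 1 + 1 := by ring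
      rw [h5, h4, h3]
      exact ⟨(h1.trans_lt h2).le, fun _ => h1.trans_lt h2⟩
  refine ⟨fun i => pos (ι (rho i)) (s i (rho i)), col, ?_, ?_, ?_⟩
  · intro i _ j _ h
    exact pos1 _ _ _ _ (hι h)
  · intro i hi j hj h hij
    obtain ⟨d, rfl⟩ : ∃ d, j = i + 3 * d := ⟨(j - i) / 3, by omega⟩
    have := (mono3 d i hj).2 (by omega)
    show pos (ι (rho i)) (s i (rho i)) < pos (ι (rho (i + 3 * d))) (s (i + 3 * d) (rho (i + 3 * d)))
    rw [req (i + 3 * d) i (by omega)]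
    exact pos2 _ _ _ this
  · intro i hi j hj hij hj2
    have hsj : s j (rho j) = s i (rho j) := by
      obtain rfl | rfl : j = i + 1 ∨ j = i + 2 := by omega
      · exact step i hi _ (rne _ _ (by omega))
      · rw [step (i+1) (by omega) _ (rne _ _ (by omega))]
        exact step i hi _ (rne _ _ (by omega))
    show c s(pos (ι (rho i)) (s i (rho i)), pos (ι (rho j)) (s j (rho j))) = col
    rw [hsj]
    exact hcol (s i) (hs i hi.le) _ _ (rne _ _ (by omega))

theorem exists_sorting (V : Type) [Fintype V] (n : ℕ) (hn : Fintype.card V = n)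
    (key : V → ℕ) (hkey : Function.Injective key) :
    ∃ σ : V ≃ Fin n, ∀ u v, σ u < σ v → key u < key v := by
  letI : LinearOrder V := LinearOrder.lift' key hkey
  let φ := Fintype.orderIsoFinOfCardEq V hn
  refine ⟨φ.symm.toEquiv, fun u v h => ?_⟩
  have : u < v := by
    have := φ.symm.lt_iff_lt (x := u) (y := v)
    exact this.1 h
  exact this


theorem stmt19 :
    ∃ C : ℝ, 0 < C ∧
      ∀ (n : ℕ) (V : Type) [Fintype V] [DecidableEq V]
        (G : SimpleGraph V) [DecidableRel G.Adj],
        Fintype.card V = n → (∀ v, G.degree v ≤ 2) →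
        ∃ σ : V ≃ Fin n, ∀ N : ℕ, C * n ≤ N →
          ∀ c : Sym2 (Fin N) → Bool,
            ∃ (f : Fin n → Fin N) (col : Bool), StrictMono f ∧
              ∀ u v : V, G.Adj u v → c s(f (σ u), f (σ v)) = col := by
  refine ⟨7782, by norm_num, ?_⟩
  intro n V _ _ G _ hn hd
  obtain ⟨τ, hτ, hτn, hadj⟩ := bandwidth_two V G hd
  rw [hn] at hτn
  have hkey : Function.Injective (fun v => (τ v % 3) * n + τ v / 3) := by
    intro u v h
    apply hτ
    have h1 := hτn u
    have h2 := hτn v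
    have h3 : (τ u % 3) * n + τ u / 3 = (τ v % 3) * n + τ v / 3 := h
    have a1 : τ u % 3 = 0 ∨ τ u % 3 = 1 ∨ τ u % 3 = 2 := by omega
    have a2 : τ v % 3 = 0 ∨ τ v % 3 = 1 ∨ τ v % 3 = 2 := by omega
    rcases a1 with a1 | a1 | a1 <;> rcases a2 with a2 | a2 | a2 <;> rw [a1, a2] at h3 <;> omega
  obtain ⟨σ, hσ⟩ := exists_sorting V n hn _ hkey
  refine ⟨σ, ?_⟩
  intro N hN c
  rcases Nat.eq_zero_or_pos n with rfl | hn0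
  · exact ⟨fun i => i.elim0, true, fun i => i.elim0, fun u => (σ u).elim0⟩
  obtain ⟨g, col, g1, g2, g3⟩ := square_path n hn0 N (by exact_mod_cast hN) c
  refine ⟨fun j => g (τ (σ.symm j)), col, ?_, ?_⟩
  · intro j j' hjj
    have h := hσ (σ.symm j) (σ.symm j') (by simpa using hjj)
    have h1 := hτn (σ.symm j)
    have h2 := hτn (σ.symm j')
    show g (τ (σ.symm j)) < g (τ (σ.symm j'))
    generalize τ (σ.symm j) = a at *
    generalize τ (σ.symm j') = b at *
    rcases lt_trichotomy (a % 3) (b % 3) with h3 | h3 | h3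
    · exact g1 a h1 b h2 h3
    · refine g2 a h1 b h2 h3 ?_
      rw [h3] at h
      omega
    · exfalso
      have : (b % 3 + 1) * n ≤ a % 3 * n := Nat.mul_le_mul_right _ h3
      rw [Nat.add_mul] at this
      omega
  · intro u v huv
    simp only [Equiv.symm_apply_apply]
    have h1 := hadj u v huv
    have h2 := hadj v u huv.symm
    have h3 : τ u ≠ τ v := fun h => huv.ne (hτ h)
    rcases lt_or_gt_of_ne h3 with h | h
    · exact g3 _ (hτn u) _ (hτn v) h h2
    · rw [Sym2.eq_swap]
      exact g3 _ (hτn v) _ (hτn u) h h1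
end
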